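/- arXiv:2308.04921 — 3 statements merged into one kernel-verified Lean document; each statement's English description precedes it below -/
import Mathlib

section
/- Let ρ_rp(z) = sign(z)|z|^{2/p} with p ∈ (1,2), and let w : [0,T) → ℝ^N with T ∈ (0,∞] be any regular reparametrized gradient flow under Assumptions (B1) and (A3) and with A ∈ ℝ^{M×N}, y ∈ ℝ^M satisfying Assumption (B2). Then: (a) if T < ∞, the limit lim_{t→T} w(t) exists and w is not a maximal solution (it can be extended beyond T); (b) if w is (extended to) a regular solution on [0,∞), then w converges to some w_∞ ∈ ℝ^N with 𝓛(w_∞) = 0, and the loss decays at the rate 𝓛̃(w̃(t)) ≤ D_F(z̃₀, w̃₀)/t for all t > 0. -/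
open Filter Topology Set
open scoped ENNReal

noncomputable section

/-- Euclidean gradient of `f : ℝ^k → ℝ`: coordinatewise the Fréchet derivative applied to
the standard basis vectors. -/
def grad {k : ℕ} (f : (Fin k → ℝ) → ℝ) (x : Fin k → ℝ) : Fin k → ℝ :=
  fun i => fderiv ℝ f x (Pi.single i 1)

/-- `w` solves the gradient-flow ODE `w' = -∇F(w)` on `[0, T)`, where `T ∈ (0, ∞]` is coded
as an element of `ℝ≥0∞`. -/
def IsGradFlowOn {k : ℕ} (F : (Fin k → ℝ) → ℝ) (T : ℝ≥0∞) (w : ℝ → Fin k → ℝ) : Prop :=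
  ∀ t : ℝ, 0 ≤ t → ENNReal.ofReal t < T →
    HasDerivWithinAt w (-(grad F (w t))) (Set.Ici 0) t

/-- A reparametrized flow is regular if `ρ'` vanishes at some coordinate of `w t` for only
finitely many times `t` in the domain `[0, T)`. -/
def RegularFlow {k : ℕ} (ρ : ℝ → ℝ) (T : ℝ≥0∞) (w : ℝ → Fin k → ℝ) : Prop :=
  {t : ℝ | 0 ≤ t ∧ ENNReal.ofReal t < T ∧ ∃ i, deriv ρ (w t i) = 0}.Finite

/-- The filter of "`t → T` from within `[0,T)`", with `T = ∞` meaning `t → ∞`. -/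
def endFilter (T : ℝ≥0∞) : Filter ℝ :=
  if T = ⊤ then Filter.atTop else nhdsWithin T.toReal (Set.Iio T.toReal)

/-- Entrywise ℓp-norm on `ℝ^k`. -/
def lpNorm {k : ℕ} (p : ℝ) (z : Fin k → ℝ) : ℝ := (∑ i, |z i| ^ p) ^ (1 / p)

/-- Euclidean norm on `ℝ^k`. -/
def euclNorm {k : ℕ} (z : Fin k → ℝ) : ℝ := Real.sqrt (∑ i, (z i) ^ 2)

/-- Bregman divergence associated with `F(z) = ∑ i, H (z i)`, whose gradient is `h = H'`
applied entrywise. -/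
def bregman {k : ℕ} (H h : ℝ → ℝ) (p q : Fin k → ℝ) : ℝ :=
  (∑ i, H (p i)) - (∑ i, H (q i)) - ∑ i, h (q i) * (p i - q i)

/-- Assumption (A3) on the loss function: continuously differentiable, convex in the first
argument, with minimum `0` attained exactly on the diagonal. -/
structure LossA3 {m : ℕ} (L : (Fin m → ℝ) → (Fin m → ℝ) → ℝ) : Prop where
  contDiff : ContDiff ℝ 1 (Function.uncurry L)
  convexOn_fst : ∀ y, ConvexOn ℝ Set.univ fun z => L z y
  nonneg : ∀ z z', 0 ≤ L z z'
  eq_zero_iff : ∀ z z', L z z' = 0 ↔ z = z'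

/-- Assumption (A1) on the link function. -/
structure LinkA1 {m : ℕ} (ρlink : ℝ → ℝ) (y : Fin m → ℝ) : Prop where
  contDiff : ContDiff ℝ 1 ρlink
  injective : Function.Injective ρlink
  mem_image : ∀ j, ∃ x : ℝ, ρlink x = y j

/-- Assumption (A2) on the reparametrization `ρ : ℝ → D` with inverse `ρinv`:
continuously differentiable and invertible, derivative nonzero outside a finite set, and
`([ρ⁻¹]')²` integrable on every compact subset of `D`. -/
structure RepA2 (ρ : ℝ → ℝ) (D : Set ℝ) (ρinv : ℝ → ℝ) : Prop where
  contDiff : ContDiff ℝ 1 ρ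
  mapsTo : ∀ x : ℝ, ρ x ∈ D
  left_inv : ∀ x : ℝ, ρinv (ρ x) = x
  right_inv : ∀ z ∈ D, ρ (ρinv z) = z
  finite_critical : {x : ℝ | deriv ρ x = 0}.Finite
  loc_integrable : ∀ C : Set ℝ, C ⊆ D → IsCompact C →
    MeasureTheory.IntegrableOn (fun z => (deriv ρinv z) ^ 2) C

/-- The reparametrization `ρ(z) = sign(z) |z|^{2/p}`. -/
def rhoPoly (p z : ℝ) : ℝ := Real.sign z * |z| ^ (2 / p)

/-- `h(z) = p²/(4(p-1)) sign(z) |z|^{p-1}`, a continuous antiderivative of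
`h'(z) = ([ρ⁻¹]'(z))² = p²/4 |z|^{p-2}`. -/
def hPoly (p z : ℝ) : ℝ := p ^ 2 / (4 * (p - 1)) * Real.sign z * |z| ^ (p - 1)

/-- `H(z) = p/(4(p-1)) |z|^p`, a continuous antiderivative of `hPoly`. -/
def HPoly (p z : ℝ) : ℝ := p / (4 * (p - 1)) * |z| ^ p

theorem exists_solution_of_hasCompactSupport {E : Type*} [NormedAddCommGroup E] [NormedSpace ℝ E]
    [FiniteDimensional ℝ E] {f : E → E} (hf : Continuous f) (hsupp : HasCompactSupport f) (x₀ : E) :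
    ∃ x : ℝ → E, x 0 = x₀ ∧ ∀ t ∈ Ioo (-1 : ℝ) 1, HasDerivAt x (f (x t)) t := by
  have : ProperSpace E := FiniteDimensional.proper_real E
  obtain ⟨B, hB⟩ := hsupp.exists_bound_of_continuous hf
  have hB0 : 0 ≤ B := (norm_nonneg _).trans (hB x₀)
  have happrox : ∀ n : ℕ, ∃ g : E → E, (∀ z, dist (g z) (f z) < 1 / ((n : ℝ) + 1)) ∧
      ∃ x : ℝ → E, x 0 = x₀ ∧
        ∀ t ∈ Icc (-1 : ℝ) 1, HasDerivWithinAt x (g (x t)) (Icc (-1) 1) t := by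
    intro n
    have hn : (0 : ℝ) < 1 / ((n : ℝ) + 1) := Nat.one_div_pos_of_nat
    obtain ⟨g, hg, hgf, hgs⟩ := hf.exists_contDiff_approx 1
      (ε := fun _ => 1 / ((n : ℝ) + 1)) continuous_const (fun _ => hn)
    have hgc : HasCompactSupport g := hsupp.mono hgs
    obtain ⟨K, hK⟩ := ContDiff.lipschitzWith_of_hasCompactSupport hgc hg (by simp)
    obtain ⟨C, hC⟩ := hgc.exists_bound_of_continuous hg.continuous
    have hC0 : 0 ≤ C := (norm_nonneg _).trans (hC x₀)
    have hPL : IsPicardLindelof (fun _ => g) (tmin := -1) (tmax := 1)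
        ⟨0, by norm_num, by norm_num⟩ x₀ ⟨C, hC0⟩ 0 ⟨C, hC0⟩ K :=
      IsPicardLindelof.of_time_independent (fun z _ => hC z) hK.lipschitzOnWith (by simp)
    obtain ⟨x, hx0, hx⟩ := hPL.exists_eq_forall_mem_Icc_hasDerivWithinAt₀
    exact ⟨g, hgf, x, hx0, hx⟩
  choose g hg x hx0 hx using happrox
  have hgB : ∀ n z, ‖g n z‖ ≤ B + 1 := by
    intro n z
    have h1 := hg n z
    have h2 : (1 : ℝ) / ((n : ℝ) + 1) ≤ 1 := by
      rw [div_le_one (by positivity)]; linarith [n.cast_nonneg (α := ℝ)]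
    have h3 : ‖g n z‖ ≤ ‖f z‖ + ‖g n z - f z‖ := norm_le_norm_add_norm_sub' _ _
    rw [dist_eq_norm] at h1
    linarith [hB z]
  have hlip : ∀ n, ∀ s ∈ Icc (-1 : ℝ) 1, ∀ t ∈ Icc (-1 : ℝ) 1,
      ‖x n t - x n s‖ ≤ (B + 1) * ‖t - s‖ := fun n s hs t ht =>
    (convex_Icc (-1 : ℝ) 1).norm_image_sub_le_of_norm_hasDerivWithin_le (hx n)
      (fun r _ => hgB n _) hs ht
  have hlim : ∀ t : ℝ, ∃ z : E, t ∈ Icc (-1 : ℝ) 1 →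
      Tendsto (fun n => x n t) (hyperfilter ℕ) (𝓝 z) := by
    intro t
    by_cases ht : t ∈ Icc (-1 : ℝ) 1
    · obtain ⟨z, -, hz⟩ := (isCompact_closedBall x₀ ((B + 1) * ‖t - 0‖)).ultrafilter_le_nhds
        ((hyperfilter ℕ).map fun n => x n t) (by
          rw [Ultrafilter.coe_map, le_principal_iff]
          refine Filter.mem_map.2 (Filter.univ_mem' fun n => ?_)
          have := hlip n 0 (by norm_num) t ht
          rw [hx0] at this
          simpa [dist_eq_norm] using this)
      exact ⟨z, fun _ => hz⟩
    · exact ⟨0, fun h => absurd h ht⟩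
  choose X hX using hlim
  refine ⟨X, ?_, ?_⟩
  · have h := hX 0 (by norm_num)
    simp only [hx0] at h
    exact tendsto_nhds_unique h tendsto_const_nhds
  intro t ht
  have htI : t ∈ Icc (-1 : ℝ) 1 := Ioo_subset_Icc_self ht
  rw [hasDerivAt_iff_isLittleO, Asymptotics.isLittleO_iff]
  intro c hc
  obtain ⟨δ, hδ, hfδ⟩ := Metric.continuousAt_iff.1 (hf.continuousAt (x := X t)) (c / 2) (half_pos hc)
  have hB1 : 0 < B + 1 := by linarith
  have hball : ∀ᶠ s in 𝓝 t, s ∈ Metric.ball t (δ / (2 * (B + 1))) :=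
    Metric.ball_mem_nhds _ (by positivity)
  obtain ⟨η, hη, hηs⟩ := Metric.eventually_nhds_iff_ball.1
    (hball.and (isOpen_Ioo.mem_nhds ht))
  refine Metric.eventually_nhds_iff_ball.2 ⟨η, hη, fun s hs => ?_⟩
  have hsI : s ∈ Icc (-1 : ℝ) 1 := Ioo_subset_Icc_self (hηs s hs).2
  have hev : ∀ᶠ n in (hyperfilter ℕ : Filter ℕ),
      ‖x n s - x n t - (s - t) • f (X t)‖ ≤ c * ‖s - t‖ := by
    have h1 : ∀ᶠ n in (hyperfilter ℕ : Filter ℕ), dist (x n t) (X t) < δ / 2 :=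
      (hX t htI).eventually (Metric.ball_mem_nhds _ (half_pos hδ))
    have h2 : ∀ᶠ n : ℕ in (hyperfilter ℕ : Filter ℕ), 1 / ((n : ℝ) + 1) < c / 2 :=
      (tendsto_one_div_add_atTop_nhds_zero_nat.mono_left Nat.hyperfilter_le_atTop).eventually
        (gt_mem_nhds (half_pos hc))
    filter_upwards [h1, h2] with n h1 h2
    have hmv := (convex_ball t η).norm_image_sub_le_of_norm_hasDerivWithin_le
      (f := fun r => x n r - (r - t) • f (X t)) (f' := fun r => g n (x n r) - f (X t))
      (C := c) (x := t) (y := s) (fun r hr => ?_) (fun r hr => ?_)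
      (Metric.mem_ball_self hη) hs
    · simpa [sub_right_comm] using hmv
    · have hd := (hx n r (Ioo_subset_Icc_self (hηs r hr).2)).mono
        (fun q hq => Ioo_subset_Icc_self (hηs q hq).2 : Metric.ball t η ⊆ Icc (-1) 1)
      have hlin := ((hasDerivWithinAt_id r (Metric.ball t η)).sub_const t).smul_const (f (X t))
      rw [one_smul] at hlin
      exact hd.sub hlin
    · have hr1 := (hηs r hr).1
      have hl := hlip n t htI r (Ioo_subset_Icc_self (hηs r hr).2)
      rw [Metric.mem_ball, dist_eq_norm] at hr1
      have hl2 : (B + 1) * ‖r - t‖ < δ / 2 := by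
        rw [lt_div_iff₀ (by positivity)] at hr1
        linarith
      have hdist : dist (x n r) (X t) < δ := by
        have h3 := dist_triangle (x n r) (x n t) (X t)
        rw [dist_eq_norm (x n r) (x n t)] at h3
        linarith
      have h4 := hfδ hdist
      have h5 := hg n (x n r)
      rw [← dist_eq_norm]
      linarith [dist_triangle (g n (x n r)) (f (x n r)) (f (X t))]
  exact le_of_tendsto
    ((((hX s hsI).sub (hX t htI)).sub_const ((s - t) • f (X t))).norm) hev

/-- **Peano existence theorem** for autonomous equations. -/
theorem exists_solution_of_continuous {E : Type*} [NormedAddCommGroup E] [NormedSpace ℝ E]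
    [FiniteDimensional ℝ E] {f : E → E} (hf : Continuous f) (t₀ : ℝ) (x₀ : E) :
    ∃ ε : ℝ, 0 < ε ∧ ∃ x : ℝ → E, x t₀ = x₀ ∧
      ∀ t ∈ Ioo (t₀ - ε) (t₀ + ε), HasDerivAt x (f (x t)) t := by
  let χ : ContDiffBump x₀ := ⟨1, 2, one_pos, one_lt_two⟩
  obtain ⟨x, hx0, hx⟩ := exists_solution_of_hasCompactSupport (f := fun z => χ z • f z)
    (χ.continuous.smul hf) (χ.hasCompactSupport.smul_right) x₀
  have hcont : ContinuousAt x 0 := (hx 0 (by norm_num)).continuousAt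
  have hev : ∀ᶠ s in 𝓝 (0 : ℝ), s ∈ Ioo (-1 : ℝ) 1 ∧ x s ∈ Metric.closedBall x₀ 1 :=
    Filter.Eventually.and (isOpen_Ioo.mem_nhds (by norm_num))
      (hcont.eventually (hx0 ▸ Metric.closedBall_mem_nhds _ one_pos))
  obtain ⟨ε, hε, hεs⟩ := Metric.eventually_nhds_iff_ball.1 hev
  refine ⟨ε, hε, fun t => x (t - t₀), by simpa using hx0, fun t ht => ?_⟩
  obtain ⟨h1, h2⟩ := hεs (t - t₀) (by
    rw [Metric.mem_ball, Real.dist_eq, abs_lt]; constructor <;> linarith [ht.1, ht.2])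
  have h3 := hx _ h1
  rw [χ.one_of_mem_closedBall h2, one_smul] at h3
  exact h3.comp_sub_const t t₀

/-- The odd extension `x ↦ sign(x) |x|^e` of the power function. -/
def signedPow (e x : ℝ) : ℝ := Real.sign x * |x| ^ e

theorem abs_signedPow {e : ℝ} (he : e ≠ 0) (x : ℝ) : |signedPow e x| = |x| ^ e := by
  unfold signedPow
  rcases lt_trichotomy x 0 with h | rfl | h
  · rw [Real.sign_of_neg h]
    simp [abs_of_nonneg (Real.rpow_nonneg (abs_nonneg x) e)]
  · simp [Real.zero_rpow he]
  · rw [Real.sign_of_pos h]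
    simp [abs_of_nonneg (Real.rpow_nonneg (abs_nonneg x) e)]

theorem sign_signedPow (e x : ℝ) : Real.sign (signedPow e x) = Real.sign x := by
  unfold signedPow
  rcases lt_trichotomy x 0 with h | rfl | h
  · have := Real.rpow_pos_of_pos (abs_pos.2 h.ne) e
    rw [Real.sign_of_neg h, Real.sign_of_neg (by linarith)]
  · simp
  · have := Real.rpow_pos_of_pos (abs_pos.2 h.ne') e
    rw [Real.sign_of_pos h, Real.sign_of_pos (by linarith)]

theorem signedPow_signedPow {e : ℝ} (he : e ≠ 0) (f x : ℝ) :
    signedPow f (signedPow e x) = signedPow (e * f) x := by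
  rw [signedPow, sign_signedPow, abs_signedPow he, ← Real.rpow_mul (abs_nonneg x), signedPow]

theorem signedPow_mul_signedPow {e f : ℝ} (hef : e + f ≠ 0) (x : ℝ) :
    signedPow e x * signedPow f x = |x| ^ (e + f) := by
  unfold signedPow
  rcases lt_trichotomy x 0 with h | rfl | h
  · rw [Real.sign_of_neg h, Real.rpow_add (abs_pos.2 h.ne)]; ring
  · simp [Real.zero_rpow hef]
  · rw [Real.sign_of_pos h, Real.rpow_add (abs_pos.2 h.ne')]; ring

theorem continuous_signedPow {e : ℝ} (he : 0 < e) : Continuous (signedPow e) := by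
  have hc : Continuous fun x : ℝ => |x| ^ e :=
    continuous_abs.rpow_const fun _ => Or.inr he.le
  have : signedPow e = fun x : ℝ => if 0 ≤ x then |x| ^ e else -|x| ^ e := by
    funext x
    unfold signedPow
    rcases lt_trichotomy x 0 with h | rfl | h
    · rw [Real.sign_of_neg h, if_neg h.not_ge]; ring
    · simp [Real.zero_rpow he.ne']
    · rw [Real.sign_of_pos h, if_pos h.le]; ring
  rw [this]
  exact hc.if_le hc.neg continuous_const continuous_id fun x hx => by
    simp [← hx, Real.zero_rpow he.ne']

theorem hasDerivAt_signedPow_of_ne (e : ℝ) {x : ℝ} (hx : x ≠ 0) :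
    HasDerivAt (signedPow e) (e * |x| ^ (e - 1)) x := by
  rcases hx.lt_or_gt with h | h
  · have hd := ((Real.hasDerivAt_rpow_const (p := e) (Or.inl (neg_ne_zero.2 hx))).comp x
      (hasDerivAt_neg x)).neg
    rw [abs_of_neg h]
    refine (hd.congr_of_eventuallyEq ?_).congr_deriv (by ring)
    filter_upwards [Iio_mem_nhds h] with y hy
    have hy' : y < 0 := hy
    simp [signedPow, Real.sign_of_neg hy', abs_of_neg hy']
  · have hd := Real.hasDerivAt_rpow_const (p := e) (Or.inl hx)
    rw [abs_of_pos h]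
    refine hd.congr_of_eventuallyEq ?_
    filter_upwards [Ioi_mem_nhds h] with y hy
    have hy' : 0 < y := hy
    simp [signedPow, Real.sign_of_pos hy', abs_of_pos hy']

theorem hasDerivAt_signedPow {e : ℝ} (he : 1 < e) (x : ℝ) :
    HasDerivAt (signedPow e) (e * |x| ^ (e - 1)) x := by
  by_cases hx : x = 0
  · subst hx
    refine hasDerivAt_of_hasDerivAt_of_ne (g := fun x => e * |x| ^ (e - 1))
      (fun y hy => hasDerivAt_signedPow_of_ne e hy)
      (continuous_signedPow (by linarith)).continuousAt ?_
    exact (continuous_const.mul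
      (continuous_abs.rpow_const fun _ => Or.inr (by linarith))).continuousAt
  · exact hasDerivAt_signedPow_of_ne e hx

theorem rhoPoly_eq (p : ℝ) : rhoPoly p = signedPow (2 / p) := rfl

theorem continuous_rhoPoly {p : ℝ} (hp : 0 < p) : Continuous (rhoPoly p) :=
  continuous_signedPow (by positivity)

theorem hasDerivAt_rhoPoly {p : ℝ} (hp1 : 1 < p) (hp2 : p < 2) (x : ℝ) :
    HasDerivAt (rhoPoly p) (2 / p * |x| ^ (2 / p - 1)) x :=
  hasDerivAt_signedPow (by rwa [lt_div_iff₀ (by linarith), one_mul]) x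

theorem hPoly_rhoPoly {p : ℝ} (hp : 0 < p) (x : ℝ) :
    hPoly p (rhoPoly p x) = p ^ 2 / (4 * (p - 1)) * signedPow (2 - 2 / p) x := by
  have h : 2 - 2 / p = 2 / p * (p - 1) := by field_simp
  rw [h, ← signedPow_signedPow (by positivity : 2 / p ≠ 0), hPoly, rhoPoly_eq]
  simp only [signedPow, mul_assoc]

theorem abs_rhoPoly_rpow {p : ℝ} (hp : 0 < p) (x : ℝ) : |rhoPoly p x| ^ p = x ^ 2 := by
  rw [rhoPoly_eq, abs_signedPow (by positivity), ← Real.rpow_mul (abs_nonneg x),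
    div_mul_cancel₀ _ hp.ne']
  norm_num

theorem hPoly_rhoPoly_mul {p : ℝ} (hp : 0 < p) (x : ℝ) :
    hPoly p (rhoPoly p x) * rhoPoly p x = p ^ 2 / (4 * (p - 1)) * x ^ 2 := by
  rw [hPoly_rhoPoly hp, rhoPoly_eq, mul_assoc, signedPow_mul_signedPow (by simp)]
  norm_num

theorem hasDerivAt_hPoly_rhoPoly {p : ℝ} (hp1 : 1 < p) {x : ℝ} (hx : x ≠ 0) :
    HasDerivAt (fun x => hPoly p (rhoPoly p x)) (p / 2 * |x| ^ (1 - 2 / p)) x := by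
  have hp : 0 < p := by linarith
  have hp' : p - 1 ≠ 0 := by linarith
  have h := (hasDerivAt_signedPow_of_ne (2 - 2 / p) hx).const_mul (p ^ 2 / (4 * (p - 1)))
  simp only [← hPoly_rhoPoly hp] at h
  refine h.congr_deriv ?_
  rw [show 2 - 2 / p - 1 = 1 - 2 / p by ring, ← mul_assoc]
  congr 1
  field_simp
  norm_num

theorem continuous_hPoly_rhoPoly {p : ℝ} (hp1 : 1 < p) :
    Continuous fun x => hPoly p (rhoPoly p x) := by
  have hp : 0 < p := by linarith
  simp only [hPoly_rhoPoly hp]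
  refine continuous_const.mul (continuous_signedPow ?_)
  rw [sub_pos, div_lt_iff₀ hp]
  linarith

/-- The coordinate contribution to the Bregman divergence between `z` and `rhoPoly p v`. -/
def bregmanTerm (p z v : ℝ) : ℝ := HPoly p z + p / 4 * v ^ 2 - hPoly p (rhoPoly p v) * z

theorem bregman_rhoPoly {p : ℝ} (hp1 : 1 < p) {k : ℕ} (z v : Fin k → ℝ) :
    bregman (HPoly p) (hPoly p) z (fun i => rhoPoly p (v i)) =
      ∑ i, bregmanTerm p (z i) (v i) := by
  have hp : 0 < p := by linarith
  have hp' : p - 1 ≠ 0 := by linarith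
  rw [bregman, ← Finset.sum_sub_distrib, ← Finset.sum_sub_distrib]
  refine Finset.sum_congr rfl fun i _ => ?_
  rw [mul_sub, hPoly_rhoPoly_mul hp, bregmanTerm, HPoly, HPoly, abs_rhoPoly_rpow hp]
  field_simp
  ring

theorem sign_mul_le_abs (x z : ℝ) : Real.sign x * z ≤ |z| := by
  rcases Real.sign_apply_eq x with h | h | h <;> rw [h]
  · simpa using neg_le_abs z
  · simp
  · simpa using le_abs_self z

theorem conj_rpow {p : ℝ} (hp1 : 1 < p) (v : ℝ) :
    (|v| ^ (2 - 2 / p)) ^ p.conjExponent = v ^ 2 := by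
  have hp' : p - 1 ≠ 0 := by linarith
  rw [← Real.rpow_mul (abs_nonneg v), Real.conjExponent,
    show (2 - 2 / p) * (p / (p - 1)) = 2 by field_simp]
  norm_num

theorem bregmanTerm_eq {p : ℝ} (hp1 : 1 < p) (z v : ℝ) :
    bregmanTerm p z v = p ^ 2 / (4 * (p - 1)) *
      ((|z| ^ p / p + (|v| ^ (2 - 2 / p)) ^ p.conjExponent / p.conjExponent -
          |z| * |v| ^ (2 - 2 / p)) +
        |v| ^ (2 - 2 / p) * (|z| - Real.sign v * z)) := by
  have hp' : p - 1 ≠ 0 := by linarith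
  rw [bregmanTerm, hPoly_rhoPoly (by linarith), conj_rpow hp1, HPoly, signedPow,
    Real.conjExponent]
  field_simp
  ring

theorem bregmanTerm_nonneg {p : ℝ} (hp1 : 1 < p) (z v : ℝ) : 0 ≤ bregmanTerm p z v := by
  have hp' : 0 < p - 1 := by linarith
  rw [bregmanTerm_eq hp1]
  have h1 := Real.young_inequality_of_nonneg (abs_nonneg z)
    (Real.rpow_nonneg (abs_nonneg v) (2 - 2 / p)) (Real.HolderConjugate.conjExponent hp1)
  have h2 := mul_nonneg (Real.rpow_nonneg (abs_nonneg v) (2 - 2 / p))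
    (sub_nonneg.2 (sign_mul_le_abs v z))
  exact mul_nonneg (by positivity) (add_nonneg (sub_nonneg.2 h1) h2)

theorem bregmanTerm_rhoPoly_self {p : ℝ} (hp1 : 1 < p) (v : ℝ) :
    bregmanTerm p (rhoPoly p v) v = 0 := by
  have hp : 0 < p := by linarith
  have hp' : p - 1 ≠ 0 := by linarith
  rw [bregmanTerm, hPoly_rhoPoly_mul hp, HPoly, abs_rhoPoly_rpow hp]
  field_simp
  ring

theorem eq_of_bregmanTerm_rhoPoly_eq_zero {p : ℝ} (hp1 : 1 < p) {u v : ℝ}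
    (h : bregmanTerm p (rhoPoly p u) v = 0) : v = u := by
  have hp : 0 < p := by linarith
  have hp' : 0 < p - 1 := by linarith
  have hconj := Real.HolderConjugate.conjExponent hp1
  have hb := Real.rpow_nonneg (abs_nonneg v) (2 - 2 / p)
  have h1 := Real.young_inequality_of_nonneg (abs_nonneg (rhoPoly p u)) hb hconj
  have h2 := mul_nonneg hb (sub_nonneg.2 (sign_mul_le_abs v (rhoPoly p u)))
  rw [bregmanTerm_eq hp1, mul_eq_zero, or_iff_right (by positivity)] at h
  have h3 := (Real.young_inequality_eq_iff_of_nonneg (abs_nonneg (rhoPoly p u)) hb hconj).1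
    (by linarith)
  rw [conj_rpow hp1, abs_rhoPoly_rpow hp] at h3
  by_cases hv : v = 0
  · subst hv
    exact (by simpa using h3 : u = 0).symm
  have hu : u ≠ 0 := by
    rintro rfl
    exact hv (by simpa using h3.symm)
  have h4 : |v| ^ (2 - 2 / p) * (|rhoPoly p u| - Real.sign v * rhoPoly p u) = 0 := by linarith
  rw [mul_eq_zero, or_iff_right (Real.rpow_pos_of_pos (abs_pos.2 hv) _).ne', sub_eq_zero,
    rhoPoly_eq, abs_signedPow (by positivity), signedPow, ← mul_assoc] at h4
  have hpos := Real.rpow_pos_of_pos (abs_pos.2 hu) (2 / p)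
  rcases sq_eq_sq_iff_eq_or_eq_neg.1 h3 with h5 | h5
  · exact h5.symm
  · exfalso
    subst h5
    rcases lt_or_gt_of_ne hv with h | h
    · rw [Real.sign_of_neg h, Real.sign_of_pos (neg_pos.2 h)] at h4
      linarith
    · rw [Real.sign_of_pos h, Real.sign_of_neg (neg_lt_zero.2 h)] at h4
      linarith

theorem sq_le_bregmanTerm {p : ℝ} (hp1 : 1 < p) (z v : ℝ) :
    p / 8 * v ^ 2 ≤ bregmanTerm p z v + HPoly p (2 * z) / 2 := by
  have h := bregmanTerm_nonneg hp1 (2 * z) v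
  have hH : 0 ≤ HPoly p z :=
    mul_nonneg (div_nonneg (by linarith) (by linarith)) (Real.rpow_nonneg (abs_nonneg z) p)
  simp only [bregmanTerm] at h ⊢
  linarith

theorem continuous_bregmanTerm {p : ℝ} (hp1 : 1 < p) (z : ℝ) :
    Continuous (bregmanTerm p z) := by
  unfold bregmanTerm
  exact (continuous_const.add (continuous_const.mul (continuous_pow 2))).sub
    ((continuous_hPoly_rhoPoly hp1).mul continuous_const)

theorem mul_abs_rpow_eq_rhoPoly {p : ℝ} (hp : 0 < p) (x : ℝ) :
    x * |x| ^ (2 / p - 1) = rhoPoly p x := by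
  rcases eq_or_ne x 0 with rfl | hx
  · simp [rhoPoly]
  have hsign : Real.sign x * |x| = x := by
    rcases hx.lt_or_gt with h | h
    · rw [Real.sign_of_neg h, abs_of_neg h, neg_one_mul, neg_neg]
    · rw [Real.sign_of_pos h, abs_of_pos h, one_mul]
  nth_rewrite 1 [← hsign]
  rw [rhoPoly, mul_assoc, ← Real.rpow_one_add' (abs_nonneg x) (by simpa using hp.ne'),
    add_sub_cancel]

theorem ConvexOn.add_fderiv_le {E : Type*} [NormedAddCommGroup E] [NormedSpace ℝ E] {f : E → ℝ}
    (hf : ConvexOn ℝ univ f) {a : E} (hd : DifferentiableAt ℝ f a) (b : E) :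
    f a + fderiv ℝ f a (b - a) ≤ f b := by
  have hc : ConvexOn ℝ univ (f ∘ AffineMap.lineMap (k := ℝ) a b) := by
    simpa using hf.comp_affineMap (AffineMap.lineMap (k := ℝ) a b)
  have hd' : HasDerivAt (f ∘ AffineMap.lineMap (k := ℝ) a b) (fderiv ℝ f a (b - a)) 0 := by
    refine HasFDerivAt.comp_hasDerivAt (0 : ℝ) ?_ AffineMap.hasDerivAt_lineMap
    simpa using hd.hasFDerivAt
  have h := hc.le_slope_of_hasDerivAt (mem_univ 0) (mem_univ 1) one_pos hd'
  simp only [slope_def_field, Function.comp_apply, AffineMap.lineMap_apply_one,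
    AffineMap.lineMap_apply_zero, sub_zero, div_one] at h
  linarith

theorem hasDerivAt_of_finite_exceptions {f g : ℝ → ℝ} {U S : Set ℝ} (hU : IsOpen U)
    (hS : S.Finite) (hf : ContinuousOn f U) (hg : ContinuousOn g U)
    (hd : ∀ s ∈ U, s ∉ S → HasDerivAt f (g s) s) {t : ℝ} (ht : t ∈ U) :
    HasDerivAt f (g t) t := by
  have hV : U ∩ (S \ {t})ᶜ ∈ 𝓝 t :=
    (hU.inter (hS.subset sdiff_subset).isClosed.isOpen_compl).mem_nhds ⟨ht, by simp⟩
  have hdV : ∀ s ∈ U ∩ (S \ {t})ᶜ ∩ {t}ᶜ, HasDerivAt f (g s) s := fun s hs =>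
    hd s hs.1.1 fun h => hs.1.2 ⟨h, hs.2⟩
  have hW : U ∩ (S \ {t})ᶜ ∩ {t}ᶜ ∈ 𝓝[≠] t :=
    inter_mem (mem_nhdsWithin_of_mem_nhds hV) self_mem_nhdsWithin
  have hlim : Tendsto (deriv f) (𝓝[≠] t) (𝓝 (g t)) := by
    refine Tendsto.congr' ?_
      (((hg t ht).continuousAt (hU.mem_nhds ht)).tendsto.mono_left nhdsWithin_le_nhds)
    filter_upwards [hW] with s hs using (hdV s hs).deriv.symm
  have hdiff : DifferentiableOn ℝ f (U ∩ (S \ {t})ᶜ ∩ {t}ᶜ) := fun s hs =>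
    (hdV s hs).differentiableAt.differentiableWithinAt
  have hcont := ((hf t ht).continuousAt (hU.mem_nhds ht)).continuousWithinAt
    (s := U ∩ (S \ {t})ᶜ ∩ {t}ᶜ)
  have h1 := hasDerivWithinAt_Ici_of_tendsto_deriv hdiff hcont
    (nhdsWithin_mono t (fun _ h => ne_of_gt h) hW)
    (hlim.mono_left (nhdsWithin_mono t fun _ h => ne_of_gt h))
  have h2 := hasDerivWithinAt_Iic_of_tendsto_deriv hdiff hcont
    (nhdsWithin_mono t (fun _ h => ne_of_lt h) hW)
    (hlim.mono_left (nhdsWithin_mono t fun _ h => ne_of_lt h))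
  simpa [Ici_union_Iic] using h1.union h2

/-- The loss `ℓ` evaluated at the linear image of the reparametrized variable. -/
def reparamLoss {N M : ℕ} (ℓ : (Fin M → ℝ) → ℝ) (A : Matrix (Fin M) (Fin N) ℝ) (p : ℝ)
    (v : Fin N → ℝ) : ℝ :=
  ℓ (A.mulVec fun i => rhoPoly p (v i))

/-- The `i`-th partial derivative of `z ↦ ℓ (A z)` at the reparametrized variable. -/
def innerPartial {N M : ℕ} (ℓ : (Fin M → ℝ) → ℝ) (A : Matrix (Fin M) (Fin N) ℝ) (p : ℝ)
    (v : Fin N → ℝ) (i : Fin N) : ℝ :=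
  fderiv ℝ ℓ (A.mulVec fun i => rhoPoly p (v i)) (A.mulVec (Pi.single i 1))

theorem linearMap_apply_eq_sum {k : ℕ} (φ : (Fin k → ℝ) →ₗ[ℝ] ℝ) (u : Fin k → ℝ) :
    φ u = ∑ i, u i * φ (Pi.single i 1) := by
  conv_lhs => rw [pi_eq_sum_univ' u]
  simp only [map_sum, map_smul, smul_eq_mul]

section Reparam

variable {N M : ℕ} {ℓ : (Fin M → ℝ) → ℝ} {A : Matrix (Fin M) (Fin N) ℝ} {p : ℝ}

theorem sum_mul_innerPartial (v u : Fin N → ℝ) :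
    ∑ i, innerPartial ℓ A p v i * u i =
      fderiv ℝ ℓ (A.mulVec fun i => rhoPoly p (v i)) (A.mulVec u) := by
  have h := linearMap_apply_eq_sum
    ((fderiv ℝ ℓ (A.mulVec fun i => rhoPoly p (v i))).toLinearMap ∘ₗ A.mulVecLin) u
  simp only [LinearMap.comp_apply, Matrix.mulVecLin_apply, ContinuousLinearMap.coe_coe] at h
  rw [h]
  exact Finset.sum_congr rfl fun i _ => mul_comm _ _

theorem continuous_reparam (hp : 0 < p) :
    Continuous fun v : Fin N → ℝ => A.mulVec fun i => rhoPoly p (v i) :=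
  Continuous.matrix_mulVec continuous_const
    (continuous_pi fun i => (continuous_rhoPoly hp).comp (continuous_apply i))

theorem continuous_reparamLoss (hp : 0 < p) (hℓ : ContDiff ℝ 1 ℓ) :
    Continuous (reparamLoss ℓ A p) :=
  hℓ.continuous.comp (continuous_reparam hp)

theorem continuous_innerPartial (hp : 0 < p) (hℓ : ContDiff ℝ 1 ℓ) (i : Fin N) :
    Continuous fun v => innerPartial ℓ A p v i :=
  ((hℓ.continuous_fderiv (by simp)).comp (continuous_reparam hp)).clm_apply continuous_const

theorem hasFDerivAt_reparamLoss (hp1 : 1 < p) (hp2 : p < 2) (hℓ : ContDiff ℝ 1 ℓ)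
    (v : Fin N → ℝ) :
    HasFDerivAt (reparamLoss ℓ A p)
      ((fderiv ℝ ℓ (A.mulVec fun i => rhoPoly p (v i))).comp
        ((LinearMap.toContinuousLinearMap A.mulVecLin).comp
          (ContinuousLinearMap.pi fun i => (2 / p * |v i| ^ (2 / p - 1)) •
            ContinuousLinearMap.proj (R := ℝ) (φ := fun _ : Fin N => ℝ) i))) v := by
  have h1 : HasFDerivAt (fun v : Fin N → ℝ => fun i => rhoPoly p (v i))
      (ContinuousLinearMap.pi fun i => (2 / p * |v i| ^ (2 / p - 1)) •
            ContinuousLinearMap.proj (R := ℝ) (φ := fun _ : Fin N => ℝ) i) v :=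
    hasFDerivAt_pi.2 fun i =>
      HasDerivAt.comp_hasFDerivAt (f := fun v : Fin N → ℝ => v i) v
        (hasDerivAt_rhoPoly hp1 hp2 (v i)) (hasFDerivAt_apply i v)
  have h2 := (LinearMap.toContinuousLinearMap A.mulVecLin).hasFDerivAt.comp v h1
  exact HasFDerivAt.comp v
    ((hℓ.differentiable (by simp)) (A.mulVec fun i => rhoPoly p (v i))).hasFDerivAt h2

theorem grad_reparamLoss (hp1 : 1 < p) (hp2 : p < 2) (hℓ : ContDiff ℝ 1 ℓ) (v : Fin N → ℝ)
    (i : Fin N) :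
    grad (reparamLoss ℓ A p) v i = 2 / p * |v i| ^ (2 / p - 1) * innerPartial ℓ A p v i := by
  rw [grad, (hasFDerivAt_reparamLoss hp1 hp2 hℓ v).fderiv]
  have h : (fun j => (2 / p * |v j| ^ (2 / p - 1)) * (Pi.single i 1 : Fin N → ℝ) j) =
      (2 / p * |v i| ^ (2 / p - 1)) • (Pi.single i 1 : Fin N → ℝ) := by
    ext j
    by_cases hj : j = i
    · subst hj; simp
    · simp [hj]
  change fderiv ℝ ℓ _ (A.mulVec fun j => (2 / p * |v j| ^ (2 / p - 1)) *
    (Pi.single i 1 : Fin N → ℝ) j) = _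
  rw [h, Matrix.mulVec_smul, map_smul, smul_eq_mul, innerPartial]

theorem continuous_grad_reparamLoss (hp1 : 1 < p) (hp2 : p < 2) (hℓ : ContDiff ℝ 1 ℓ) :
    Continuous (grad (reparamLoss ℓ A p)) := by
  have hp : 0 < p := by linarith
  refine continuous_pi fun i => ?_
  simp only [grad_reparamLoss hp1 hp2 hℓ]
  refine (continuous_const.mul ?_).mul (continuous_innerPartial hp hℓ i)
  refine (continuous_apply i).abs.rpow_const fun _ => Or.inr ?_
  rw [sub_nonneg, le_div_iff₀ hp]
  linarith

theorem fderiv_apply_grad {k : ℕ} (F : (Fin k → ℝ) → ℝ) (v u : Fin k → ℝ) :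
    fderiv ℝ F v u = ∑ i, u i * grad F v i :=
  linearMap_apply_eq_sum (fderiv ℝ F v).toLinearMap u

section Flow

variable {T : ℝ≥0∞} {w : ℝ → Fin N → ℝ}

theorem IsGradFlowOn.hasDerivAt {k : ℕ} {F : (Fin k → ℝ) → ℝ} {w : ℝ → Fin k → ℝ}
    (h : IsGradFlowOn F T w) {t : ℝ} (ht : 0 < t) (htT : ENNReal.ofReal t < T) :
    HasDerivAt w (-(grad F (w t))) t :=
  (h t ht.le htT).hasDerivAt (Ici_mem_nhds ht)

theorem le_of_hasDerivAt_nonpos {f f' : ℝ → ℝ}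
    (hf : ContinuousOn f {t | 0 ≤ t ∧ ENNReal.ofReal t < T})
    (hd : ∀ t, 0 < t → ENNReal.ofReal t < T → HasDerivAt f (f' t) t ∧ f' t ≤ 0)
    {a b : ℝ} (ha : 0 ≤ a) (hab : a ≤ b) (hb : ENNReal.ofReal b < T) : f b ≤ f a := by
  have hT : ∀ s ≤ b, ENNReal.ofReal s < T := fun s hs =>
    (ENNReal.ofReal_le_ofReal hs).trans_lt hb
  have hd' : ∀ s ∈ interior (Icc a b), HasDerivAt f (f' s) s ∧ f' s ≤ 0 := by
    intro s hs
    rw [interior_Icc] at hs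
    exact hd s (ha.trans_lt hs.1) (hT s hs.2.le)
  refine antitoneOn_of_deriv_nonpos (convex_Icc a b)
    (hf.mono fun s hs => ⟨ha.trans hs.1, hT s hs.2⟩)
    (fun s hs => (hd' s hs).1.differentiableAt.differentiableWithinAt)
    (fun s hs => ?_) (left_mem_Icc.2 hab) (right_mem_Icc.2 hab) hab
  rw [(hd' s hs).1.deriv]
  exact (hd' s hs).2

theorem IsGradFlowOn.continuousOn {k : ℕ} {F : (Fin k → ℝ) → ℝ} {w : ℝ → Fin k → ℝ}
    (h : IsGradFlowOn F T w) : ContinuousOn w {t | 0 ≤ t ∧ ENNReal.ofReal t < T} :=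
  fun t ht => (h t ht.1 ht.2).continuousWithinAt.mono fun _ hs => hs.1

theorem hasDerivAt_dual (hp1 : 1 < p) (hp2 : p < 2) (hℓ : ContDiff ℝ 1 ℓ)
    (hflow : IsGradFlowOn (reparamLoss ℓ A p) T w) (hreg : RegularFlow (rhoPoly p) T w)
    {t : ℝ} (ht : 0 < t) (htT : ENNReal.ofReal t < T) (i : Fin N) :
    HasDerivAt (fun s => hPoly p (rhoPoly p (w s i))) (-innerPartial ℓ A p (w t) i) t := by
  have hp : 0 < p := by linarith
  have hwc : ContinuousOn w {s | 0 < s ∧ ENNReal.ofReal s < T} :=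
    hflow.continuousOn.mono fun s hs => ⟨hs.1.le, hs.2⟩
  have hU : IsOpen {s : ℝ | 0 < s ∧ ENNReal.ofReal s < T} :=
    (isOpen_lt continuous_const continuous_id).inter
      (isOpen_lt ENNReal.continuous_ofReal continuous_const)
  refine hasDerivAt_of_finite_exceptions (g := fun s => -innerPartial ℓ A p (w s) i) hU hreg
    ((continuous_hPoly_rhoPoly hp1).comp_continuousOn
      ((continuous_apply i).comp_continuousOn hwc))
    ((continuous_innerPartial hp hℓ i).comp_continuousOn hwc).neg
    (fun s hs hsS => ?_) ⟨ht, htT⟩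
  have hne : w s i ≠ 0 := by
    intro h0
    refine hsS ⟨hs.1.le, hs.2, i, ?_⟩
    have hq : 2 / p - 1 ≠ 0 := by
      rw [sub_ne_zero, Ne, div_eq_one_iff_eq hp.ne']
      exact hp2.ne'
    rw [(hasDerivAt_rhoPoly hp1 hp2 _).deriv, h0, abs_zero, Real.zero_rpow hq, mul_zero]
  have hw := hasDerivAt_pi.1 (hflow.hasDerivAt hs.1 hs.2) i
  refine ((hasDerivAt_hPoly_rhoPoly hp1 hne).comp s hw).congr_deriv ?_
  rw [Pi.neg_apply, grad_reparamLoss hp1 hp2 hℓ, ← neg_sub (2 / p) 1,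
    Real.rpow_neg (abs_nonneg _)]
  have := (Real.rpow_pos_of_pos (abs_pos.2 hne) (2 / p - 1)).ne'
  field_simp

theorem hasDerivAt_loss (hp1 : 1 < p) (hp2 : p < 2) (hℓ : ContDiff ℝ 1 ℓ)
    (hflow : IsGradFlowOn (reparamLoss ℓ A p) T w)
    {t : ℝ} (ht : 0 < t) (htT : ENNReal.ofReal t < T) :
    HasDerivAt (fun s => reparamLoss ℓ A p (w s))
      (-∑ i, grad (reparamLoss ℓ A p) (w t) i ^ 2) t := by
  have h := (hasFDerivAt_reparamLoss (A := A) hp1 hp2 hℓ (w t)).differentiableAt.hasFDerivAt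
    |>.comp_hasDerivAt t (hflow.hasDerivAt ht htT)
  refine h.congr_deriv ?_
  rw [fderiv_apply_grad, ← Finset.sum_neg_distrib]
  exact Finset.sum_congr rfl fun i _ => by rw [Pi.neg_apply]; ring

theorem hasDerivAt_bregman (hp1 : 1 < p) (hp2 : p < 2) (hℓ : ContDiff ℝ 1 ℓ)
    (hflow : IsGradFlowOn (reparamLoss ℓ A p) T w) (hreg : RegularFlow (rhoPoly p) T w)
    (z : Fin N → ℝ) {t : ℝ} (ht : 0 < t) (htT : ENNReal.ofReal t < T) :
    HasDerivAt (fun s => ∑ i, bregmanTerm p (z i) (w s i))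
      (fderiv ℝ ℓ (A.mulVec fun i => rhoPoly p (w t i))
        (A.mulVec z - A.mulVec fun i => rhoPoly p (w t i))) t := by
  have hp : 0 < p := by linarith
  rw [← Matrix.mulVec_sub, ← sum_mul_innerPartial]
  refine HasDerivAt.fun_sum fun i _ => ?_
  have hw := hasDerivAt_pi.1 (hflow.hasDerivAt ht htT) i
  have h := (((hw.pow 2).const_mul (p / 4)).const_add (HPoly p (z i))).sub
    ((hasDerivAt_dual hp1 hp2 hℓ hflow hreg ht htT i).mul_const (z i))
  refine h.congr_deriv ?_
  rw [Pi.neg_apply, grad_reparamLoss hp1 hp2 hℓ, Pi.sub_apply, ← mul_abs_rpow_eq_rhoPoly hp]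
  field_simp
  push_cast
  ring

theorem fderiv_apply_sub_le (hℓ : ContDiff ℝ 1 ℓ) (hc : ConvexOn ℝ univ ℓ)
    {y : Fin M → ℝ} (hy : ℓ y = 0) (a : Fin M → ℝ) : fderiv ℝ ℓ a (y - a) ≤ -ℓ a := by
  have h := hc.add_fderiv_le ((hℓ.differentiable (by simp)) a) y
  linarith

theorem continuousOn_bregman (hp1 : 1 < p) (hflow : IsGradFlowOn (reparamLoss ℓ A p) T w)
    (z : Fin N → ℝ) : ContinuousOn (fun s => ∑ i, bregmanTerm p (z i) (w s i))
      {t | 0 ≤ t ∧ ENNReal.ofReal t < T} :=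
  continuousOn_finsetSum _ fun i _ => (continuous_bregmanTerm hp1 (z i)).comp_continuousOn
    ((continuous_apply i).comp_continuousOn hflow.continuousOn)

theorem bregman_antitone (hp1 : 1 < p) (hp2 : p < 2) (hℓ : ContDiff ℝ 1 ℓ)
    (hc : ConvexOn ℝ univ ℓ) (h0 : ∀ a, 0 ≤ ℓ a)
    (hflow : IsGradFlowOn (reparamLoss ℓ A p) T w) (hreg : RegularFlow (rhoPoly p) T w)
    {z : Fin N → ℝ} (hz : ℓ (A.mulVec z) = 0) {a b : ℝ} (ha : 0 ≤ a) (hab : a ≤ b)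
    (hb : ENNReal.ofReal b < T) :
    ∑ i, bregmanTerm p (z i) (w b i) ≤ ∑ i, bregmanTerm p (z i) (w a i) :=
  le_of_hasDerivAt_nonpos (continuousOn_bregman hp1 hflow z)
    (fun _ ht htT => ⟨hasDerivAt_bregman hp1 hp2 hℓ hflow hreg z ht htT,
      (fderiv_apply_sub_le hℓ hc hz _).trans (neg_nonpos.2 (h0 _))⟩) ha hab hb

theorem bregman_add_mul_loss_le (hp1 : 1 < p) (hp2 : p < 2) (hℓ : ContDiff ℝ 1 ℓ)
    (hc : ConvexOn ℝ univ ℓ)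
    (hflow : IsGradFlowOn (reparamLoss ℓ A p) T w) (hreg : RegularFlow (rhoPoly p) T w)
    {z : Fin N → ℝ} (hz : ℓ (A.mulVec z) = 0) {t : ℝ} (ht : 0 ≤ t)
    (htT : ENNReal.ofReal t < T) :
    ∑ i, bregmanTerm p (z i) (w t i) + t * reparamLoss ℓ A p (w t) ≤
      ∑ i, bregmanTerm p (z i) (w 0 i) := by
  have hp : 0 < p := by linarith
  have h := le_of_hasDerivAt_nonpos
    (f := fun t => ∑ i, bregmanTerm p (z i) (w t i) + t * reparamLoss ℓ A p (w t))
    ((continuousOn_bregman hp1 hflow z).add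
      (continuousOn_id.mul ((continuous_reparamLoss hp hℓ).comp_continuousOn hflow.continuousOn)))
    (fun s hs hsT => ⟨(hasDerivAt_bregman hp1 hp2 hℓ hflow hreg z hs hsT).add
      ((hasDerivAt_id s).mul (hasDerivAt_loss hp1 hp2 hℓ hflow hs hsT)), ?_⟩) le_rfl ht htT
  · simpa using h
  · have h1 := fderiv_apply_sub_le hℓ hc hz (A.mulVec fun i => rhoPoly p (w s i))
    have h2 : 0 ≤ s * ∑ i, grad (reparamLoss ℓ A p) (w s) i ^ 2 :=
      mul_nonneg hs.le (Finset.sum_nonneg fun i _ => sq_nonneg _)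
    simp only [id, reparamLoss] at h2 ⊢
    linarith

theorem exists_mem_closedBall (hp1 : 1 < p) (hp2 : p < 2) (hℓ : ContDiff ℝ 1 ℓ)
    (hc : ConvexOn ℝ univ ℓ) (h0 : ∀ a, 0 ≤ ℓ a)
    (hflow : IsGradFlowOn (reparamLoss ℓ A p) T w) (hreg : RegularFlow (rhoPoly p) T w)
    {z : Fin N → ℝ} (hz : ℓ (A.mulVec z) = 0) :
    ∃ R : ℝ, ∀ t, 0 ≤ t → ENNReal.ofReal t < T → w t ∈ Metric.closedBall 0 R := by
  let C := ∑ i, bregmanTerm p (z i) (w 0 i)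
  let B := ∑ i, HPoly p (2 * z i) / 2
  have hH : ∀ x, 0 ≤ HPoly p x := fun x =>
    mul_nonneg (div_nonneg (by linarith) (by linarith)) (Real.rpow_nonneg (abs_nonneg x) p)
  refine ⟨√(8 / p * (C + B)), fun t ht htT => ?_⟩
  rw [mem_closedBall_zero_iff, pi_norm_le_iff_of_nonneg (Real.sqrt_nonneg _)]
  intro i
  refine Real.abs_le_sqrt ?_
  have h1 := bregman_antitone hp1 hp2 hℓ hc h0 hflow hreg hz le_rfl ht htT
  have h2 := sq_le_bregmanTerm hp1 (z i) (w t i)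
  have h3 : bregmanTerm p (z i) (w t i) ≤ ∑ i, bregmanTerm p (z i) (w t i) :=
    Finset.single_le_sum (fun i _ => bregmanTerm_nonneg hp1 (z i) (w t i)) (Finset.mem_univ i)
  have h4 : HPoly p (2 * z i) / 2 ≤ B :=
    Finset.single_le_sum (f := fun i => HPoly p (2 * z i) / 2)
      (fun i _ => div_nonneg (hH _) zero_le_two) (Finset.mem_univ i)
  have h5 : p / 8 * w t i ^ 2 ≤ C + B := by linarith
  calc w t i ^ 2 = 8 / p * (p / 8 * w t i ^ 2) := by field_simp
    _ ≤ _ := mul_le_mul_of_nonneg_left h5 (by positivity)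

end Flow

end Reparam

section Convergence

variable {N M : ℕ} {ℓ : (Fin M → ℝ) → ℝ} {A : Matrix (Fin M) (Fin N) ℝ} {p : ℝ} {T : ℝ≥0∞}
  {w : ℝ → Fin N → ℝ}

theorem exists_tendsto_of_bounded_deriv {E : Type*} [NormedAddCommGroup E] [NormedSpace ℝ E]
    [FiniteDimensional ℝ E] {f f' : ℝ → E} {a b C : ℝ}
    (hd : ∀ t ∈ Ico a b, HasDerivWithinAt f (f' t) (Ici a) t) (hC : ∀ t ∈ Ico a b, ‖f' t‖ ≤ C)
    (hab : a < b) : ∃ x, Tendsto f (𝓝[<] b) (𝓝 x) := by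
  have : CompleteSpace E := FiniteDimensional.complete ℝ E
  have hlip : LipschitzOnWith C.toNNReal f (Ico a b) :=
    (convex_Ico a b).lipschitzOnWith_of_nnnorm_hasDerivWithin_le
      (fun t ht => (hd t ht).mono Ico_subset_Ici_self)
      fun t ht => by
        rw [← NNReal.coe_le_coe, coe_nnnorm]
        exact (hC t ht).trans (Real.le_coe_toNNReal C)
  have hle : 𝓝[<] b ≤ 𝓟 (Ico a b) := le_principal_iff.2 (Ico_mem_nhdsLT hab)
  exact CompleteSpace.complete
    ((cauchy_nhds.mono nhdsWithin_le_nhds).map_of_le hlip.uniformContinuousOn hle)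

theorem IsGradFlowOn.exists_extension {k : ℕ} {F : (Fin k → ℝ) → ℝ} (hF : Continuous (grad F))
    {w : ℝ → Fin k → ℝ} {b : ℝ} (hb : 0 < b) (hflow : IsGradFlowOn F (ENNReal.ofReal b) w)
    {x : Fin k → ℝ} (hx : Tendsto w (𝓝[<] b) (𝓝 x)) :
    ∃ ε : ℝ, 0 < ε ∧ ∃ w2 : ℝ → Fin k → ℝ,
      IsGradFlowOn F (ENNReal.ofReal b + ENNReal.ofReal ε) w2 ∧ ∀ t < b, w2 t = w t := by
  obtain ⟨ε, hε, u, hu0, hu⟩ := exists_solution_of_continuous hF.neg b x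
  let w2 : ℝ → Fin k → ℝ := fun t => if t < b then w t else u t
  have hw : ∀ t < b, w2 t = w t := fun t ht => if_pos ht
  have hu' : ∀ t, b ≤ t → w2 t = u t := fun t ht => if_neg ht.not_gt
  refine ⟨ε, hε, w2, fun t ht htT => ?_, hw⟩
  rw [← ENNReal.ofReal_add hb.le hε.le, ENNReal.ofReal_lt_ofReal_iff (by positivity)] at htT
  rcases lt_trichotomy t b with htb | rfl | htb
  · rw [hw t htb]
    have heq : w2 =ᶠ[𝓝 t] w := by
      filter_upwards [Iio_mem_nhds htb] with s hs using hw s hs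
    exact (hflow t ht ((ENNReal.ofReal_lt_ofReal_iff hb).2 htb)).congr_of_eventuallyEq
      (heq.filter_mono nhdsWithin_le_nhds) (hw t htb)
  · have hder : ∀ s ∈ Ioo 0 t, HasDerivAt w2 (-(grad F (w s))) s := fun s hs =>
      (hflow.hasDerivAt hs.1 ((ENNReal.ofReal_lt_ofReal_iff hb).2 hs.2)).congr_of_eventuallyEq
        (by filter_upwards [Iio_mem_nhds hs.2] with r hr using hw r hr)
    have hw2t : w2 t = x := (hu' t le_rfl).trans hu0
    have hmem : Ioo 0 t ∈ 𝓝[<] t := Ioo_mem_nhdsLT hb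
    have hleft : HasDerivWithinAt w2 (-(grad F x)) (Iic t) t := by
      refine hasDerivWithinAt_Iic_of_tendsto_deriv
        (fun s hs => (hder s hs).differentiableAt.differentiableWithinAt) ?_ hmem ?_
      · rw [ContinuousWithinAt, hw2t]
        refine (hx.mono_left (nhdsWithin_mono t fun s hs => hs.2)).congr' ?_
        filter_upwards [self_mem_nhdsWithin] with s hs using (hw s hs.2).symm
      · refine ((hF.neg.tendsto x).comp hx).congr' ?_
        filter_upwards [hmem] with s hs using (hder s hs).deriv.symm
    have hright : HasDerivWithinAt w2 (-(grad F x)) (Ici t) t := by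
      have h := (hu t ⟨by linarith, by linarith⟩).hasDerivWithinAt (s := Ici t)
      rw [hu0] at h
      exact h.congr (fun s hs => hu' s hs) (hu' t le_rfl)
    rw [hw2t]
    have h := hleft.union hright
    rw [Iic_union_Ici] at h
    exact h.mono (subset_univ _)
  · rw [hu' t htb.le]
    exact ((hu t ⟨by linarith, htT⟩).congr_of_eventuallyEq
      (by filter_upwards [Ioi_mem_nhds htb] with s hs using hu' s (le_of_lt hs))).hasDerivWithinAt

theorem exists_tendsto_of_lt_top (hp1 : 1 < p) (hp2 : p < 2) (hℓ : ContDiff ℝ 1 ℓ)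
    (hc : ConvexOn ℝ univ ℓ) (h0 : ∀ a, 0 ≤ ℓ a) {b : ℝ} (hb : 0 < b)
    (hflow : IsGradFlowOn (reparamLoss ℓ A p) (ENNReal.ofReal b) w)
    (hreg : RegularFlow (rhoPoly p) (ENNReal.ofReal b) w)
    {z : Fin N → ℝ} (hz : ℓ (A.mulVec z) = 0) : ∃ x, Tendsto w (𝓝[<] b) (𝓝 x) := by
  obtain ⟨R, hR⟩ := exists_mem_closedBall hp1 hp2 hℓ hc h0 hflow hreg hz
  obtain ⟨C, hC⟩ := (isCompact_closedBall (0 : Fin N → ℝ) R).exists_bound_of_continuousOn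
    (continuous_grad_reparamLoss (A := A) hp1 hp2 hℓ).neg.continuousOn
  have hlt : ∀ t ∈ Ico 0 b, ENNReal.ofReal t < ENNReal.ofReal b := fun t ht =>
    (ENNReal.ofReal_lt_ofReal_iff hb).2 ht.2
  exact exists_tendsto_of_bounded_deriv (fun t ht => hflow t ht.1 (hlt t ht))
    (fun t ht => hC _ (hR t ht.1 (hlt t ht))) hb

theorem reparamLoss_le_div (hp1 : 1 < p) (hp2 : p < 2) (hℓ : ContDiff ℝ 1 ℓ)
    (hc : ConvexOn ℝ univ ℓ)
    (hflow : IsGradFlowOn (reparamLoss ℓ A p) T w) (hreg : RegularFlow (rhoPoly p) T w)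
    {z : Fin N → ℝ} (hz : ℓ (A.mulVec z) = 0) {t : ℝ} (ht : 0 < t)
    (htT : ENNReal.ofReal t < T) :
    reparamLoss ℓ A p (w t) ≤
      bregman (HPoly p) (hPoly p) z (fun i => rhoPoly p (w 0 i)) / t := by
  rw [le_div_iff₀ ht, bregman_rhoPoly hp1]
  have h1 := bregman_add_mul_loss_le hp1 hp2 hℓ hc hflow hreg hz ht.le htT
  have h2 : 0 ≤ ∑ i, bregmanTerm p (z i) (w t i) :=
    Finset.sum_nonneg fun i _ => bregmanTerm_nonneg hp1 (z i) (w t i)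
  linarith

theorem exists_tendsto_atTop (hp1 : 1 < p) (hp2 : p < 2) (hℓ : ContDiff ℝ 1 ℓ)
    (hc : ConvexOn ℝ univ ℓ) (h0 : ∀ a, 0 ≤ ℓ a)
    (hflow : IsGradFlowOn (reparamLoss ℓ A p) ⊤ w) (hreg : RegularFlow (rhoPoly p) ⊤ w)
    {z : Fin N → ℝ} (hz : ℓ (A.mulVec z) = 0) :
    ∃ x, Tendsto w atTop (𝓝 x) ∧ reparamLoss ℓ A p x = 0 := by
  obtain ⟨R, hR⟩ := exists_mem_closedBall hp1 hp2 hℓ hc h0 hflow hreg hz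
  have hmem : ∀ᶠ t in atTop, w t ∈ Metric.closedBall 0 R :=
    (eventually_ge_atTop 0).mono fun t ht => hR t ht ENNReal.ofReal_lt_top
  have hK := isCompact_closedBall (0 : Fin N → ℝ) R
  obtain ⟨x, -, hx⟩ := hK.exists_mapClusterPt (tendsto_principal.2 hmem)
  have eq_of_tendsto : ∀ {G : (Fin N → ℝ) → ℝ} {l : ℝ} {v : Fin N → ℝ}, Continuous G →
      MapClusterPt v atTop w → Tendsto (G ∘ w) atTop (𝓝 l) → G v = l := by
    intro G l v hG hv hl
    have h : MapClusterPt (G v) atTop (G ∘ w) := hv.continuousAt_comp hG.continuousAt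
    exact eq_of_nhds_neBot (h.clusterPt.neBot.mono (inf_le_inf_left _ hl))
  have hloss : Tendsto (reparamLoss ℓ A p ∘ w) atTop (𝓝 0) := by
    refine squeeze_zero' (.of_forall fun t => h0 _) ?_ (tendsto_const_nhds.div_atTop tendsto_id
      (a := bregman (HPoly p) (hPoly p) z fun i => rhoPoly p (w 0 i)))
    filter_upwards [eventually_gt_atTop 0] with t ht
    exact reparamLoss_le_div hp1 hp2 hℓ hc hflow hreg hz ht ENNReal.ofReal_lt_top
  have hx0 := eq_of_tendsto (continuous_reparamLoss (by linarith) hℓ) hx hloss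
  refine ⟨x, ?_, hx0⟩
  let G : (Fin N → ℝ) → ℝ := fun v => ∑ i, bregmanTerm p (rhoPoly p (x i)) (v i)
  have hG : Continuous G := continuous_finsetSum _ fun i _ =>
    (continuous_bregmanTerm hp1 _).comp (continuous_apply i)
  have hterm : ∀ (v : Fin N → ℝ) i, 0 ≤ bregmanTerm p (rhoPoly p (x i)) (v i) := fun v i =>
    bregmanTerm_nonneg hp1 _ _
  have hanti : Antitone fun t : ℝ => G (w (max t 0)) := fun a b hab =>
    bregman_antitone hp1 hp2 hℓ hc h0 hflow hreg (z := fun i => rhoPoly p (x i)) hx0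
      (le_max_right a 0) (max_le_max_right 0 hab) ENNReal.ofReal_lt_top
  have hlim : Tendsto (G ∘ w) atTop (𝓝 (⨅ t : ℝ, G (w (max t 0)))) := by
    refine (tendsto_atTop_ciInf hanti ⟨0, ?_⟩).congr' ?_
    · rintro _ ⟨t, rfl⟩
      exact Finset.sum_nonneg fun i _ => hterm _ i
    · filter_upwards [eventually_ge_atTop 0] with t ht
      simp [max_eq_left ht]
  have hGx : G x = 0 := Finset.sum_eq_zero fun i _ => bregmanTerm_rhoPoly_self hp1 (x i)
  refine hK.tendsto_nhds_of_unique_mapClusterPt hmem fun v _ hv => ?_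
  have hGv : G v = 0 := by
    rw [eq_of_tendsto hG hv hlim, ← eq_of_tendsto hG hx hlim, hGx]
  ext i
  exact eq_of_bregmanTerm_rhoPoly_eq_zero hp1
    ((Finset.sum_eq_zero_iff_of_nonneg fun i _ => hterm v i).1 hGv i (Finset.mem_univ i))

end Convergence

/-- Convergence of polynomially reparametrized gradient flow. -/
theorem statement13 {N M : ℕ} (p : ℝ) (hp1 : 1 < p) (hp2 : p < 2)
    (A : Matrix (Fin M) (Fin N) ℝ) (y : Fin M → ℝ)
    (zt0 : Fin N → ℝ) (hzt0 : A.mulVec zt0 = y)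
    (L : (Fin M → ℝ) → (Fin M → ℝ) → ℝ) (hA3 : LossA3 L)
    (T : ℝ≥0∞) (hT : 0 < T) (w : ℝ → Fin N → ℝ)
    (hflow : IsGradFlowOn (fun z => L (A.mulVec fun i => rhoPoly p (z i)) y) T w)
    (hreg : RegularFlow (rhoPoly p) T w) :
    (T ≠ ⊤ →
      (∃ wT : Fin N → ℝ, Tendsto w (endFilter T) (𝓝 wT)) ∧
      ∃ ε : ℝ, 0 < ε ∧ ∃ w2 : ℝ → Fin N → ℝ,
        IsGradFlowOn (fun z => L (A.mulVec fun i => rhoPoly p (z i)) y)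
          (T + ENNReal.ofReal ε) w2 ∧
        ∀ t : ℝ, 0 ≤ t → ENNReal.ofReal t < T → w2 t = w t) ∧
    (T = ⊤ →
      ∃ winf : Fin N → ℝ,
        Tendsto w atTop (𝓝 winf) ∧
        L (A.mulVec fun i => rhoPoly p (winf i)) y = 0 ∧
        ∀ t : ℝ, 0 < t →
          L (A.mulVec fun i => rhoPoly p (w t i)) y ≤
            bregman (HPoly p) (hPoly p) zt0 (fun i => rhoPoly p (w 0 i)) / t) := by
  have hℓ : ContDiff ℝ 1 fun z => L z y := hA3.contDiff.comp (contDiff_id.prodMk contDiff_const)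
  have hc := hA3.convexOn_fst y
  have h0 : ∀ a, 0 ≤ L a y := fun a => hA3.nonneg a y
  have hz : L (A.mulVec zt0) y = 0 := (hA3.eq_zero_iff _ _).2 hzt0
  refine ⟨fun hTop => ?_, ?_⟩
  · lift T to NNReal using hTop
    have hb : (0 : ℝ) < T := by exact_mod_cast hT
    have hTb : (T : ℝ≥0∞) = ENNReal.ofReal T := (ENNReal.ofReal_coe_nnreal).symm
    have hfilter : endFilter T = 𝓝[<] (T : ℝ) := if_neg ENNReal.coe_ne_top
    rw [hfilter]
    rw [hTb] at hflow hreg ⊢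
    obtain ⟨x, hx⟩ := exists_tendsto_of_lt_top hp1 hp2 hℓ hc h0 hb hflow hreg hz
    obtain ⟨ε, hε, w2, hw2, heq⟩ :=
      IsGradFlowOn.exists_extension (continuous_grad_reparamLoss hp1 hp2 hℓ) hb hflow hx
    exact ⟨⟨x, hx⟩, ε, hε, w2, hw2, fun t _ ht =>
      heq t ((ENNReal.ofReal_lt_ofReal_iff hb).1 ht)⟩
  · rintro rfl
    obtain ⟨x, hx, hx0⟩ := exists_tendsto_atTop hp1 hp2 hℓ hc h0 hflow hreg hz
    exact ⟨x, hx, hx0, fun t ht =>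
      reparamLoss_le_div hp1 hp2 hℓ hc hflow hreg hz ht ENNReal.ofReal_lt_top⟩
end
end

section
/- Let ρ_rp(z) = sinh(z) and let w : [0,T) → ℝ^N with T ∈ (0,∞] be any solution of the reparametrized gradient flow with w̃₀ = ρ_rp(w₀) = 0, for A ∈ ℝ^{M×N}, y ∈ ℝ^M, with ρ_link and L satisfying Assumptions (A1) and (A3). If the limit w̃_T := lim_{t→T} sinh(w(t)) exists with 𝓛̃(w̃_T) = 0, then g_sinh(w̃_T) = min{ g_sinh(z̃) : z̃ ∈ ℝ^N, 𝓛̃(z̃) = 0 }, where g_sinh(z̃) = ⟨z̃, arctan(z̃)⟩ − ⟨1, ½ log(1 + z̃ ⊙ z̃)⟩ with arctan and log applied entrywise. -/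
open Filter Topology Set
open scoped ENNReal

noncomputable section

/-- `g_sinh(z) = ⟨z, arctan z⟩ - ⟨1, ½ log(1 + z ⊙ z)⟩`. -/
def gsinh {k : ℕ} (z : Fin k → ℝ) : ℝ :=
  (∑ i, z i * Real.arctan (z i)) - ∑ i, (1 / 2) * Real.log (1 + (z i) ^ 2)

/-- The tangent line inequality for the convex function `x * arctan x - log (1 + x ^ 2) / 2`,
whose derivative is `arctan`. -/
theorem arctan_primitive_tangent_le (p x : ℝ) :
    p * Real.arctan p - (1 / 2) * Real.log (1 + p ^ 2) + Real.arctan p * (x - p) ≤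
      x * Real.arctan x - (1 / 2) * Real.log (1 + x ^ 2) := by
  have hd : ∀ x : ℝ, HasDerivAt
      (fun x : ℝ => x * Real.arctan x - (1 / 2) * Real.log (1 + x ^ 2)) (Real.arctan x) x := by
    intro x
    have hpos : (1 + x ^ 2 : ℝ) ≠ 0 := by positivity
    have h := ((hasDerivAt_id x).mul (Real.hasDerivAt_arctan x)).sub
      (((((hasDerivAt_id x).pow 2).const_add 1).log hpos).const_mul (1 / 2))
    refine h.congr_deriv ?_
    simp only [id, Pi.pow_apply]
    field_simp
    ring
  have hcont : Continuous
      (fun x : ℝ => x * Real.arctan x - (1 / 2) * Real.log (1 + x ^ 2)) :=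
    continuous_iff_continuousAt.2 fun x => (hd x).continuousAt
  rcases lt_trichotomy p x with h | h | h
  · obtain ⟨c, hc, hs⟩ := exists_hasDerivAt_eq_slope _ _ h hcont.continuousOn fun c _ => hd c
    rw [eq_div_iff (by linarith)] at hs
    nlinarith [Real.arctan_strictMono.monotone hc.1.le]
  · subst h; simp
  · obtain ⟨c, hc, hs⟩ := exists_hasDerivAt_eq_slope _ _ h hcont.continuousOn fun c _ => hd c
    rw [eq_div_iff (by linarith)] at hs
    nlinarith [Real.arctan_strictMono.monotone hc.2.le]

/-- First-order convexity of `gsinh`. -/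
theorem gsinh_add_le {k : ℕ} (p z : Fin k → ℝ) :
    gsinh p + ∑ i, Real.arctan (p i) * (z i - p i) ≤ gsinh z := by
  simp only [gsinh, ← Finset.sum_sub_distrib, ← Finset.sum_add_distrib]
  exact Finset.sum_le_sum fun i _ => arctan_primitive_tangent_le (p i) (z i)

/-- A function of `A sinh(x)` has zero derivative at `x` in the direction `v / cosh(x)` whenever
`v` lies in the kernel of `A`. -/
theorem fderiv_comp_mulVec_sinh_eq_zero {N M : ℕ} (A : Matrix (Fin M) (Fin N) ℝ)
    {G : (Fin M → ℝ) → ℝ} (hG : Differentiable ℝ G) {v : Fin N → ℝ} (hv : A.mulVec v = 0)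
    (x : Fin N → ℝ) :
    fderiv ℝ (fun z => G (A.mulVec fun i => Real.sinh (z i))) x
      (fun i => v i / Real.cosh (x i)) = 0 := by
  have hs : HasFDerivAt (fun z : Fin N → ℝ => fun i => Real.sinh (z i))
      (ContinuousLinearMap.pi fun i => Real.cosh (x i) •
        ContinuousLinearMap.proj (R := ℝ) (φ := fun _ : Fin N => ℝ) i) x :=
    hasFDerivAt_pi.2 fun i =>
      (ContinuousLinearMap.proj (R := ℝ) (φ := fun _ : Fin N => ℝ) i).hasFDerivAt.sinh
  have hA := (LinearMap.toContinuousLinearMap A.mulVecLin).hasFDerivAt.comp x hs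
  have hF := (hG (A.mulVec fun i => Real.sinh (x i))).hasFDerivAt.comp x hA
  have hdir : (fun i => Real.cosh (x i) * (v i / Real.cosh (x i))) = v :=
    funext fun i => mul_div_cancel₀ _ (Real.cosh_pos (x i)).ne'
  have hval : ((fderiv ℝ G (A.mulVec fun i => Real.sinh (x i))).comp
      ((LinearMap.toContinuousLinearMap A.mulVecLin).comp
        (ContinuousLinearMap.pi fun i => Real.cosh (x i) •
          ContinuousLinearMap.proj (R := ℝ) (φ := fun _ : Fin N => ℝ) i)))
      (fun i => v i / Real.cosh (x i)) = 0 := by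
    change (fderiv ℝ G (A.mulVec fun i => Real.sinh (x i)))
      (A.mulVec fun i => Real.cosh (x i) * (v i / Real.cosh (x i))) = 0
    rw [hdir, hv, map_zero]
  rw [← hval]
  exact congrArg (fun l : (Fin N → ℝ) →L[ℝ] ℝ => l fun i => v i / Real.cosh (x i)) hF.fderiv

theorem fderiv_apply_eq_sum_grad {k : ℕ} (f : (Fin k → ℝ) → ℝ) (x u : Fin k → ℝ) :
    fderiv ℝ f x u = ∑ i, u i * grad f x i := by
  conv_lhs => rw [pi_eq_sum_univ' u]
  simp [grad, map_sum]

/-- The derivative of `arctan ∘ sinh` is `1 / cosh`. -/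
theorem hasDerivAt_arctan_sinh (x : ℝ) :
    HasDerivAt (fun x => Real.arctan (Real.sinh x)) (1 / Real.cosh x) x := by
  refine (Real.hasDerivAt_sinh x).arctan.congr_deriv ?_
  have := (Real.cosh_pos x).ne'
  rw [add_comm, ← Real.cosh_sq]
  field_simp

theorem endFilter_neBot (T : ℝ≥0∞) : (endFilter T).NeBot := by
  unfold endFilter
  split_ifs <;> infer_instance

theorem eventually_endFilter {T : ℝ≥0∞} (hT : 0 < T) :
    ∀ᶠ t in endFilter T, 0 ≤ t ∧ ENNReal.ofReal t < T := by
  unfold endFilter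
  split_ifs with h
  · filter_upwards [eventually_ge_atTop 0] with t ht
    exact ⟨ht, h ▸ ENNReal.ofReal_lt_top⟩
  · filter_upwards [Ioo_mem_nhdsLT (ENNReal.toReal_pos hT.ne' h)] with t ht
    exact ⟨ht.1.le, (ENNReal.ofReal_lt_iff_lt_toReal ht.1.le h).2 ht.2⟩

/-- Along the flow, `arctan(sinh(w))` stays orthogonal to the kernel of `A`. -/
theorem sum_mul_arctan_sinh_eq_zero {N M : ℕ} (A : Matrix (Fin M) (Fin N) ℝ)
    {G : (Fin M → ℝ) → ℝ} (hG : Differentiable ℝ G) {v : Fin N → ℝ} (hv : A.mulVec v = 0)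
    {T : ℝ≥0∞} {w : ℝ → Fin N → ℝ} (hw0 : ∀ i, Real.sinh (w 0 i) = 0)
    (hflow : IsGradFlowOn (fun z => G (A.mulVec fun i => Real.sinh (z i))) T w)
    {t : ℝ} (ht0 : 0 ≤ t) (htT : ENNReal.ofReal t < T) :
    ∑ i, v i * Real.arctan (Real.sinh (w t i)) = 0 := by
  have hd : ∀ s ∈ Icc 0 t, HasDerivWithinAt
      (fun s => ∑ i, v i * Real.arctan (Real.sinh (w s i))) 0 (Ici 0) s := by
    intro s hs
    have hw := hasDerivWithinAt_pi.1
      (hflow s hs.1 ((ENNReal.ofReal_le_ofReal hs.2).trans_lt htT))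
    have h := HasDerivWithinAt.fun_sum (u := Finset.univ) fun i _ =>
      ((hasDerivAt_arctan_sinh (w s i)).comp_hasDerivWithinAt s (hw i)).const_mul (v i)
    refine h.congr_deriv ?_
    have hz := fderiv_comp_mulVec_sinh_eq_zero A hG hv (w s)
    rw [fderiv_apply_eq_sum_grad] at hz
    rw [← neg_eq_zero, ← hz, ← Finset.sum_neg_distrib]
    refine Finset.sum_congr rfl fun i _ => ?_
    simp only [Pi.neg_apply]
    ring
  have hconst := constant_of_has_deriv_right_zero
    (fun s hs => ((hd s hs).mono Icc_subset_Ici_self).continuousWithinAt)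
    (fun s hs => (hd s (Ico_subset_Icc_self hs)).mono (Ici_subset_Ici.2 hs.1))
    t (right_mem_Icc.2 ht0)
  simpa [hw0] using hconst

/-- Implicit bias of `sinh`-reparametrized gradient flow (Corollary,
general link function). -/
theorem statement14 {N M : ℕ} (A : Matrix (Fin M) (Fin N) ℝ) (y : Fin M → ℝ)
    (ρlink : ℝ → ℝ) (hA1 : LinkA1 ρlink y)
    (L : (Fin M → ℝ) → (Fin M → ℝ) → ℝ) (hA3 : LossA3 L)
    (T : ℝ≥0∞) (hT : 0 < T) (w : ℝ → Fin N → ℝ)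
    (hw0 : ∀ i, Real.sinh (w 0 i) = 0)
    (hflow : IsGradFlowOn
      (fun z => L (fun j => ρlink ((A.mulVec fun i => Real.sinh (z i)) j)) y) T w)
    (wT : Fin N → ℝ)
    (hlim : Tendsto (fun t => fun i => Real.sinh (w t i)) (endFilter T) (𝓝 wT))
    (hfeas : L (fun j => ρlink (A.mulVec wT j)) y = 0) :
    ∀ z : Fin N → ℝ, L (fun j => ρlink (A.mulVec z j)) y = 0 → gsinh wT ≤ gsinh z := by
  intro z hz
  have hG : Differentiable ℝ fun u : Fin M → ℝ => L (fun j => ρlink (u j)) y := by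
    have hL : Differentiable ℝ (Function.uncurry L) := hA3.contDiff.differentiable one_ne_zero
    have hρ : Differentiable ℝ ρlink := hA1.contDiff.differentiable one_ne_zero
    have hpair : Differentiable ℝ fun u : Fin M → ℝ => ((fun j => ρlink (u j)), y) := by
      fun_prop
    exact hL.comp hpair
  have hAz : A.mulVec (z - wT) = 0 := by
    have h := ((hA3.eq_zero_iff _ _).1 hz).trans ((hA3.eq_zero_iff _ _).1 hfeas).symm
    rw [Matrix.mulVec_sub, sub_eq_zero]
    exact funext fun j => hA1.injective (congrFun h j)
  have := endFilter_neBot T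
  have hlim' : Tendsto (fun t => ∑ i, (z - wT) i * Real.arctan (Real.sinh (w t i)))
      (endFilter T) (𝓝 (∑ i, (z - wT) i * Real.arctan (wT i))) :=
    tendsto_finsetSum _ fun i _ => ((Real.continuous_arctan.tendsto _).comp
      (tendsto_pi_nhds.1 hlim i)).const_mul _
  have hzero : ∑ i, (z - wT) i * Real.arctan (wT i) = 0 := by
    refine tendsto_nhds_unique (hlim'.congr' ?_) tendsto_const_nhds
    filter_upwards [eventually_endFilter hT] with t ht
    exact sum_mul_arctan_sinh_eq_zero A hG hAz hw0 hflow ht.1 ht.2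
  have hconv := gsinh_add_le wT z
  simp only [Pi.sub_apply, mul_comm (z _ - wT _)] at hzero
  linarith
end
end

section
/- Let p ∈ (1,2), N ∈ ℕ, and let S ⊆ ℝ^N be a nonempty set on which the ℓ_p-norm attains its minimum μ := min_{z ∈ S} ‖z‖_p > 0. Let α > 0 satisfy α ≤ μ / (2^{1/(p−1)} N^{1/p}), and suppose w ∈ S minimizes the functional z ↦ ‖z‖_p^p − p α^{p−1} ⟨1, z⟩ over S. Then ‖w‖_p ≤ (1 + 4 N^{1−1/p} (α/μ)^{p−1}) · μ. -/
open Filter Topology Set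
open scoped ENNReal

noncomputable section

/-- Hölder's inequality against the all-ones vector. -/
theorem sum_abs_le_rpow_mul_lpNorm {N : ℕ} {p : ℝ} (hp : 1 < p) (z : Fin N → ℝ) :
    ∑ i, |z i| ≤ (N : ℝ) ^ (1 - 1 / p) * lpNorm p z := by
  have hpq := Real.HolderConjugate.conjExponent hp
  have h := Real.inner_le_Lp_mul_Lq Finset.univ (fun i => |z i|) (fun _ => (1 : ℝ)) hpq
  have hq : 1 / p.conjExponent = 1 - 1 / p := by
    have := hpq.inv_add_inv_eq_one
    simp only [one_div]
    linarith
  rw [hq] at h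
  simpa [lpNorm, mul_comm] using h

theorem lpNorm_nonneg {N : ℕ} (p : ℝ) (z : Fin N → ℝ) : 0 ≤ lpNorm p z := by
  unfold lpNorm
  positivity

theorem lpNorm_rpow {N : ℕ} {p : ℝ} (hp : p ≠ 0) (z : Fin N → ℝ) :
    lpNorm p z ^ p = ∑ i, |z i| ^ p := by
  unfold lpNorm
  rw [← Real.rpow_mul (by positivity), one_div_mul_cancel hp, Real.rpow_one]

/-- If `x ^ p - 1 ≤ p ε (x + 1)` with `ε ≤ 1 / 2`, then `x` is at most `1 + 4 ε`. -/
theorem le_one_add_of_rpow_sub_one_le {p x ε : ℝ} (hp : 1 < p) (hx : 0 ≤ x) (hε0 : 0 ≤ ε)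
    (hε : ε ≤ 1 / 2) (h : x ^ p - 1 ≤ p * ε * (x + 1)) : x ≤ 1 + 4 * ε := by
  have hb := one_add_mul_self_le_rpow_one_add (s := x - 1) (by linarith) hp.le
  rw [add_sub_cancel] at hb
  have h1 : x - 1 ≤ ε * (x + 1) := by
    have : p * (x - 1) ≤ p * (ε * (x + 1)) := by linarith
    exact le_of_mul_le_mul_left this (by linarith)
  nlinarith [mul_nonneg hε0 (sub_nonneg.2 hε)]

/-- Minimizing `‖z‖_p^p - p α^{p-1} ⟨1, z⟩` over `S` approximately
minimizes the ℓp-norm. -/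
theorem statement18 {N : ℕ} (p : ℝ) (hp1 : 1 < p) (hp2 : p < 2)
    (S : Set (Fin N → ℝ)) (hS : S.Nonempty) (μ : ℝ) (hμpos : 0 < μ)
    (hμ : IsLeast (lpNorm p '' S) μ)
    (α : ℝ) (hα : 0 < α)
    (hαμ : α ≤ μ / (2 ^ ((1 : ℝ) / (p - 1)) * (N : ℝ) ^ ((1 : ℝ) / p)))
    (w : Fin N → ℝ) (hwS : w ∈ S)
    (hwmin : ∀ z ∈ S,
      (∑ i, |w i| ^ p) - p * α ^ (p - 1) * (∑ i, w i) ≤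
      (∑ i, |z i| ^ p) - p * α ^ (p - 1) * (∑ i, z i)) :
    lpNorm p w ≤ (1 + 4 * (N : ℝ) ^ (1 - 1 / p) * (α / μ) ^ (p - 1)) * μ := by
  have hN : 0 < (N : ℝ) := by
    rcases Nat.eq_zero_or_pos N with h | h
    · subst h
      rw [Nat.cast_zero, Real.zero_rpow (by positivity), mul_zero, div_zero] at hαμ
      linarith
    · exact_mod_cast h
  have hp0 : 0 < p := by linarith
  have hp1' : 0 < p - 1 := by linarith
  obtain ⟨⟨z, hzS, hz⟩, -⟩ := hμ
  set C : ℝ := (N : ℝ) ^ (1 - 1 / p) with hC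
  have hCpos : 0 < C := Real.rpow_pos_of_pos hN _
  set b := lpNorm p w with hb
  have hb0 : 0 ≤ b := lpNorm_nonneg p w
  set r : ℝ := (α / μ) ^ (p - 1) with hr
  have hr0 : 0 ≤ r := by positivity
  have hε : C * r ≤ 1 / 2 := by
    have h1 : α / μ ≤ (2 ^ ((1 : ℝ) / (p - 1)) * (N : ℝ) ^ ((1 : ℝ) / p))⁻¹ := by
      rw [div_le_iff₀ hμpos, mul_comm, ← div_eq_mul_inv]
      exact hαμ
    have h2 : r ≤ (2 * C)⁻¹ := by
      calc r ≤ ((2 ^ ((1 : ℝ) / (p - 1)) * (N : ℝ) ^ ((1 : ℝ) / p))⁻¹) ^ (p - 1) :=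
            Real.rpow_le_rpow (by positivity) h1 hp1'.le
        _ = (2 * C)⁻¹ := by
            rw [Real.inv_rpow (by positivity), Real.mul_rpow (by positivity) (by positivity),
              ← Real.rpow_mul (by positivity), ← Real.rpow_mul hN.le,
              one_div_mul_cancel hp1'.ne', Real.rpow_one, hC]
            congr 3
            field_simp
    calc C * r ≤ C * (2 * C)⁻¹ := by gcongr
      _ = 1 / 2 := by field_simp
  have hmain : b ^ p - μ ^ p ≤ p * α ^ (p - 1) * (C * (b + μ)) := by
    have h := hwmin z hzS
    rw [← lpNorm_rpow hp0.ne', ← lpNorm_rpow hp0.ne', hz] at h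
    have hw1 : ∑ i, w i ≤ C * b :=
      (Finset.sum_le_sum fun i _ => le_abs_self (w i)).trans (sum_abs_le_rpow_mul_lpNorm hp1 w)
    have hz1 : -(∑ i, z i) ≤ C * μ := by
      have hsum := sum_abs_le_rpow_mul_lpNorm hp1 z
      rw [hz] at hsum
      exact (neg_le_abs _).trans ((Finset.abs_sum_le_sum_abs z Finset.univ).trans hsum)
    have hle : p * α ^ (p - 1) * (∑ i, w i - ∑ i, z i) ≤ p * α ^ (p - 1) * (C * (b + μ)) := by
      gcongr
      linarith
    linarith
  have hx : (b / μ) ^ p - 1 ≤ p * (C * r) * (b / μ + 1) := by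
    have hμp : 0 < μ ^ p := Real.rpow_pos_of_pos hμpos p
    have hpow : μ ^ p = μ ^ (p - 1) * μ := by
      rw [← Real.rpow_add_one hμpos.ne', sub_add_cancel]
    have hμp' : 0 < μ ^ (p - 1) := Real.rpow_pos_of_pos hμpos _
    calc (b / μ) ^ p - 1 = (b ^ p - μ ^ p) / μ ^ p := by
          rw [Real.div_rpow hb0 hμpos.le, sub_div, div_self hμp.ne']
      _ ≤ p * α ^ (p - 1) * (C * (b + μ)) / μ ^ p := by gcongr
      _ = p * (C * r) * (b / μ + 1) := by
          rw [hpow, hr, Real.div_rpow hα.le hμpos.le]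
          field_simp
  have := le_one_add_of_rpow_sub_one_le hp1 (by positivity) (by positivity) hε hx
  rw [div_le_iff₀ hμpos] at this
  rwa [mul_assoc 4]
end
end
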